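/- Let X ⊆ ℝ² be the dendroid X = [u,w] ∪ ⋃_{n ∈ ℤ⁺}[u,xₙ] ∪ ⋃_{n ∈ ℤ⁻}[w,xₙ], where u = (0,1), w = (0,−1), xₙ = (1/n, 0) for n ∈ ℤ \ {0}, and [x,y] denotes the straight line segment joining x and y, with the subspace topology of ℝ². Then the hyperspace S_c(X) has exactly 𝔠-many path-wise connected components, i.e. the set of path components of S_c(X) has cardinality continuum. -/

import Mathlib

open Set Topology

/-- The Vietoris topology on the powerset of a topological space, generated by the
standard subbasis.  Restricting it to any family of closed subsets yields the usual
Vietoris hyperspace topology on that family. -/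
def vietorisTopology (X : Type*) [TopologicalSpace X] : TopologicalSpace (Set X) :=
  TopologicalSpace.generateFrom
    {A | (∃ U : Set X, IsOpen U ∧ A = {F : Set X | F ⊆ U}) ∨
         (∃ U : Set X, IsOpen U ∧ A = {F : Set X | (F ∩ U).Nonempty})}

/-- `S` is a nontrivial convergent sequence with limit point `x`:  `S` is countably
infinite, closed, `x` is its unique non-isolated point, and `S \ U` is finite for
every open neighbourhood `U` of `x`. -/
def IsNCS {X : Type*} [TopologicalSpace X] (S : Set X) (x : X) : Prop :=
  S.Infinite ∧ S.Countable ∧ IsClosed S ∧ x ∈ S ∧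
    (¬ ∃ U : Set X, IsOpen U ∧ U ∩ S = {x}) ∧
    (∀ y ∈ S, y ≠ x → ∃ U : Set X, IsOpen U ∧ U ∩ S = {y}) ∧
    (∀ U : Set X, IsOpen U → x ∈ U → (S \ U).Finite)

/-- The hyperspace `S_c(X)` of all nontrivial convergent sequences of `X`. -/
def Sc (X : Type*) [TopologicalSpace X] : Type _ :=
  {S : Set X // ∃ x, IsNCS S x}

/-- `S_c(X)` carries the relative Vietoris topology. -/
instance (X : Type*) [TopologicalSpace X] : TopologicalSpace (Sc X) :=
  TopologicalSpace.induced (fun S => S.1) (vietorisTopology X)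

/-- The point `u = (0,1)`. -/
def uPt : ℝ × ℝ := (0, 1)
/-- The point `v = (0,0)`. -/
def vPt : ℝ × ℝ := (0, 0)
/-- The point `w = (0,-1)`. -/
def wPt : ℝ × ℝ := (0, -1)
/-- The point `xₙ = (1/n, 0)` for `n ∈ ℤ \ {0}`. -/
noncomputable def xPt (n : ℤ) : ℝ × ℝ := (1 / (n : ℝ), 0)

/-- The dendroid `X = [u,w] ∪ ⋃_{n ∈ ℤ⁺} [u,xₙ] ∪ ⋃_{n ∈ ℤ⁻} [w,xₙ] ⊆ ℝ²`,
with the subspace topology. -/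
noncomputable def dendroidX : Set (ℝ × ℝ) :=
  segment ℝ uPt wPt ∪ (⋃ n : {n : ℤ // 0 < n}, segment ℝ uPt (xPt n)) ∪
    (⋃ n : {n : ℤ // n < 0}, segment ℝ wPt (xPt n))

/-- For `A ⊆ ℤ⁺`, the set `S_A = {v} ∪ {xₙ : n ∈ A ∪ ℤ⁻}`, as a subset of the
dendroid. -/
def seqSet (A : Set ℤ) : Set ↥dendroidX :=
  {p | (p : ℝ × ℝ) = vPt ∨ ∃ n : ℤ, (n ∈ A ∨ n < 0) ∧ (p : ℝ × ℝ) = xPt n}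


open Filter Cardinal

lemma isNCS_of_tendsto {ι X : Type*} [TopologicalSpace X] [T2Space X] [Infinite ι] [Countable ι]
    (f : ι → X) (a : X) (hf : Function.Injective f) (h : Tendsto f cofinite (𝓝 a)) :
    IsNCS (insert a (range f)) a := by
  have hinf : (insert a (range f)).Infinite :=
    (Set.infinite_range_of_injective hf).mono (Set.subset_insert _ _)
  have hfin : ∀ U : Set X, IsOpen U → a ∈ U → (insert a (range f) \ U).Finite := by
    intro U hU haU
    have h1 : {i | f i ∉ U}.Finite := h (hU.mem_nhds haU)
    refine (h1.image f).subset ?_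
    rintro y ⟨hy, hyU⟩
    rcases hy with rfl | ⟨i, rfl⟩
    · exact absurd haU hyU
    · exact ⟨i, hyU, rfl⟩
  refine ⟨hinf, (Set.countable_range f).insert a, ?_, Set.mem_insert _ _, ?_, ?_, hfin⟩
  · exact (h.isCompact_insert_range_of_cofinite).isClosed
  · rintro ⟨U, hU, hUS⟩
    have haU : a ∈ U := by
      have : a ∈ U ∩ insert a (range f) := by rw [hUS]; rfl
      exact this.1
    refine hinf (((hfin U hU haU).union (Set.finite_singleton a)).subset ?_)
    intro y hy
    by_cases hyU : y ∈ U
    · right; rw [← hUS]; exact ⟨hyU, hy⟩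
    · left; exact ⟨hy, hyU⟩
  · intro y hy hya
    obtain ⟨W, U, hW, hU, hyW, haU, hd⟩ := t2_separation hya
    have hWf : ((insert a (range f) ∩ W) \ {y}).Finite := by
      refine (hfin U hU haU).subset ?_
      rintro z ⟨⟨hz, hzW⟩, -⟩
      exact ⟨hz, fun hzU => Set.disjoint_left.1 hd hzW hzU⟩
    refine ⟨W \ ((insert a (range f) ∩ W) \ {y}), hW.sdiff hWf.isClosed, ?_⟩
    ext z
    simp only [Set.mem_inter_iff, Set.mem_diff, Set.mem_singleton_iff]
    constructor
    · rintro ⟨⟨h1, h2⟩, h3⟩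
      by_contra hne
      exact h2 ⟨⟨h3, h1⟩, hne⟩
    · rintro rfl
      exact ⟨⟨hyW, fun h => h.2 rfl⟩, hy⟩

lemma dendroid_char {p : ℝ × ℝ} (hp : p ∈ dendroidX) :
    |p.2| ≤ 1 ∧ (p.1 = 0 ∨ ∃ m : ℤ, m ≠ 0 ∧ (m : ℝ) * p.1 = 1 - |p.2| ∧ 0 ≤ (m : ℝ) * p.2) := by
  rcases hp with (hp | hp) | hp
  · obtain ⟨a, b, ha, hb, hab, rfl⟩ := hp
    simp only [uPt, wPt, Prod.smul_mk, Prod.mk_add_mk, smul_eq_mul]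
    refine ⟨abs_le.2 ⟨by linarith, by linarith⟩, Or.inl (by ring)⟩
  · obtain ⟨⟨n, hn⟩, hp⟩ := Set.mem_iUnion.1 hp
    obtain ⟨a, b, ha, hb, hab, rfl⟩ := hp
    have hn' : (0 : ℝ) < n := by exact_mod_cast hn
    simp only [uPt, xPt, Prod.smul_mk, Prod.mk_add_mk, smul_eq_mul]
    have e : a * 1 + b * 0 = a := by ring
    rw [e, abs_of_nonneg ha]
    refine ⟨by linarith, Or.inr ⟨n, hn.ne', ?_, by positivity⟩⟩
    field_simp
    linarith
  · obtain ⟨⟨n, hn⟩, hp⟩ := Set.mem_iUnion.1 hp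
    obtain ⟨a, b, ha, hb, hab, rfl⟩ := hp
    have hn' : (n : ℝ) < 0 := by exact_mod_cast hn
    simp only [wPt, xPt, Prod.smul_mk, Prod.mk_add_mk, smul_eq_mul]
    have e : a * -1 + b * 0 = -a := by ring
    rw [e, abs_neg, abs_of_nonneg ha]
    refine ⟨by linarith, Or.inr ⟨n, hn.ne, ?_, by nlinarith⟩⟩
    have := hn'.ne
    field_simp
    linarith

lemma vPt_mem : vPt ∈ dendroidX :=
  Or.inl (Or.inl ⟨1/2, 1/2, by norm_num, by norm_num, by norm_num, by
    simp [uPt, wPt, vPt]⟩)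

lemma xPt_mem {n : ℤ} (hn : n ≠ 0) : xPt n ∈ dendroidX := by
  rcases lt_or_gt_of_ne hn with h | h
  · exact Or.inr (Set.mem_iUnion.2 ⟨⟨n, h⟩, right_mem_segment ℝ _ _⟩)
  · exact Or.inl (Or.inr (Set.mem_iUnion.2 ⟨⟨n, h⟩, right_mem_segment ℝ _ _⟩))

/-- The part of leg `n` at height below `c`. -/
def legPart (c : ℝ) (n : ℤ) : Set ↥dendroidX :=
  {p | |p.1.2| < c ∧ (n : ℝ) * p.1.1 = 1 - |p.1.2|}

lemma leg_iff {n : ℤ} (hn : n ≠ 0) (p : ↥dendroidX) (hp : |p.1.2| < 1) :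
    (n : ℝ) * p.1.1 = 1 - |p.1.2| ↔
      (|(n : ℝ)| + 1) * |(n : ℝ) * p.1.1 - (1 - |p.1.2|)| < 1 - |p.1.2| := by
  constructor
  · intro h
    rw [h]; simp; exact hp
  · intro h
    have h1 : 0 < 1 - |p.1.2| := by linarith
    have hn1 : 0 ≤ |(n : ℝ)| := abs_nonneg _
    rcases (dendroid_char p.2).2 with h0 | ⟨m, hm, hmx, -⟩
    · exfalso
      rw [h0, mul_zero, zero_sub, abs_neg, abs_of_pos h1] at h
      nlinarith
    · have hmx0 : (m : ℝ) ≠ 0 := by exact_mod_cast hm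
      have hx : p.1.1 ≠ 0 := by
        intro h0; rw [h0] at hmx; simp at hmx; linarith
      have hd : (n : ℝ) * p.1.1 - (1 - |p.1.2|) = (n - m) * p.1.1 := by rw [← hmx]; ring
      have ha : 1 - |p.1.2| = |(m : ℝ)| * |p.1.1| := by
        rw [← abs_mul, hmx, abs_of_pos h1]
      rw [hd, ha, abs_mul, ← mul_assoc] at h
      have h2 : (|(n : ℝ)| + 1) * |(n : ℝ) - m| < |(m : ℝ)| :=
        lt_of_mul_lt_mul_right h (abs_nonneg _)
      by_cases hnm : n = m
      · subst hnm; exact hmx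
      exfalso
      have h3 : (1 : ℝ) ≤ |(n : ℝ) - m| := by
        have : 1 ≤ |n - m| := Int.one_le_abs (sub_ne_zero.2 hnm)
        exact_mod_cast this
      have h4 : |(m : ℝ)| ≤ |(n : ℝ)| + |(n : ℝ) - m| := by
        have := abs_sub_abs_le_abs_sub (m : ℝ) n
        rw [abs_sub_comm] at this; linarith
      nlinarith

lemma isOpen_legPart {c : ℝ} (hc : c < 1) {n : ℤ} (hn : n ≠ 0) : IsOpen (legPart c n) := by
  have : legPart c n = {p : ↥dendroidX | |p.1.2| < c} ∩
      {p | (|(n : ℝ)| + 1) * |(n : ℝ) * p.1.1 - (1 - |p.1.2|)| < 1 - |p.1.2|} := by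
    ext p
    simp only [legPart, Set.mem_setOf_eq, Set.mem_inter_iff]
    exact and_congr_right fun h => leg_iff hn p (h.trans hc)
  rw [this]
  exact (isOpen_lt (by fun_prop) (by fun_prop)).inter (isOpen_lt (by fun_prop) (by fun_prop))

lemma isOpen_compl_legPart (c : ℝ) (n : ℤ) :
    IsOpen {p : ↥dendroidX | |p.1.2| ≠ c ∧ p ∉ legPart c n} := by
  have : {p : ↥dendroidX | |p.1.2| ≠ c ∧ p ∉ legPart c n} =
      {p : ↥dendroidX | c < |p.1.2|} ∪
      ({p : ↥dendroidX | |p.1.2| < c} ∩ {p | (n : ℝ) * p.1.1 ≠ 1 - |p.1.2|}) := by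
    ext p
    simp only [legPart, Set.mem_setOf_eq, Set.mem_inter_iff, Set.mem_union, not_and]
    constructor
    · rintro ⟨h1, h2⟩
      rcases lt_or_gt_of_ne h1 with h | h
      · exact Or.inr ⟨h, h2 h⟩
      · exact Or.inl h
    · rintro (h | ⟨h, h2⟩)
      · exact ⟨h.ne', fun h' => absurd h' h.not_gt⟩
      · exact ⟨h.ne, fun _ => h2⟩
  rw [this]
  exact (isOpen_lt (by fun_prop) (by fun_prop)).union
    ((isOpen_lt (by fun_prop) (by fun_prop)).inter (isOpen_ne_fun (by fun_prop) (by fun_prop)))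

/-- Indices of legs met by `S` below height `c`. -/
def legIdx (c : ℝ) (S : Set ↥dendroidX) : Set ℤ :=
  {n | n ≠ 0 ∧ (S ∩ legPart c n).Nonempty}

lemma finite_idx {T : Set ↥dendroidX} (hT : T.Finite) {E : Set ℤ}
    (h : ∀ n ∈ E, ∃ p ∈ T, |p.1.2| < 1 ∧ (n : ℝ) * p.1.1 = 1 - |p.1.2|) : E.Finite := by
  refine (hT.image (fun p => round ((1 - |p.1.2|) / p.1.1))).subset ?_
  intro n hn
  obtain ⟨p, hp, h1, h2⟩ := h n hn
  refine ⟨p, hp, ?_⟩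
  have hx : p.1.1 ≠ 0 := by
    intro h0; rw [h0] at h2; simp at h2; linarith
  simp only
  rw [← h2, mul_div_cancel_right₀ _ hx, round_intCast]

lemma limit_height {S : Set ↥dendroidX} {q : ↥dendroidX} (hS : IsNCS S q) {c : ℝ} (hc : c < 1)
    (hpos : (legIdx c S ∩ {n | 0 < n}).Infinite) (hneg : (legIdx c S ∩ {n | n < 0}).Infinite) :
    q.1.2 = 0 := by
  have hfin := hS.2.2.2.2.2.2
  have key : ∀ n : ℤ, ∀ p : ↥dendroidX, |p.1.2| < 1 → (n : ℝ) * p.1.1 = 1 - |p.1.2| →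
      0 ≤ (n : ℝ) * p.1.2 := by
    intro n p h1 h2
    rcases (dendroid_char p.2).2 with h0 | ⟨m, hm, hmx, hmy⟩
    · rw [h0] at h2; simp at h2; linarith
    · have hx : p.1.1 ≠ 0 := by
        intro h0; rw [h0] at h2; simp at h2; linarith
      have : (n : ℝ) = m := mul_right_cancel₀ hx (h2.trans hmx.symm)
      rw [this]; exact hmy
  refine le_antisymm ?_ ?_
  · by_contra hq
    push Not at hq
    refine hneg (finite_idx (hfin {p | 0 < p.1.2} (isOpen_lt (by fun_prop) (by fun_prop)) hq) ?_)
    rintro n ⟨⟨-, p, hpS, hp1, hp2⟩, hn⟩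
    have hn' : (n : ℝ) < 0 := by exact_mod_cast hn
    have := key n p (hp1.trans hc) hp2
    refine ⟨p, ⟨hpS, ?_⟩, hp1.trans hc, hp2⟩
    simp only [Set.mem_setOf_eq, not_lt]
    by_contra h
    push Not at h
    nlinarith
  · by_contra hq
    push Not at hq
    refine hpos (finite_idx (hfin {p | p.1.2 < 0} (isOpen_lt (by fun_prop) (by fun_prop)) hq) ?_)
    rintro n ⟨⟨-, p, hpS, hp1, hp2⟩, hn⟩
    have hn' : 0 < (n : ℝ) := by exact_mod_cast hn
    have := key n p (hp1.trans hc) hp2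
    refine ⟨p, ⟨hpS, ?_⟩, hp1.trans hc, hp2⟩
    simp only [Set.mem_setOf_eq, not_lt]
    by_contra h
    push Not at h
    nlinarith

lemma legIdx_diff {S : Set ↥dendroidX} {q : ↥dendroidX} (hS : IsNCS S q) (hq : q.1.2 = 0)
    {c c' : ℝ} (hc0 : 0 < c) (hc' : c' < 1) : (legIdx c' S \ legIdx c S).Finite := by
  have hfin := hS.2.2.2.2.2.2
  refine finite_idx (hfin {p | |p.1.2| < c} (isOpen_lt (by fun_prop) (by fun_prop))
    (by simp [hq, hc0])) ?_
  rintro n ⟨⟨hn, p, hpS, hp1, hp2⟩, h⟩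
  refine ⟨p, ⟨hpS, fun hp => h ⟨hn, p, hpS, hp, hp2⟩⟩, hp1.trans hc', hp2⟩

/-- Two-way infinite index sets. -/
def GoodIdx (D : Set ℤ) : Prop :=
  (D ∩ {n | 0 < n}).Infinite ∧ (D ∩ {n | n < 0}).Infinite

def AlmostEq (A B : Set ℤ) : Prop := (A \ B).Finite ∧ (B \ A).Finite

lemma AlmostEq.symm {A B : Set ℤ} (h : AlmostEq A B) : AlmostEq B A := ⟨h.2, h.1⟩

lemma AlmostEq.trans {A B C : Set ℤ} (h : AlmostEq A B) (h' : AlmostEq B C) : AlmostEq A C := by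
  constructor
  · refine (h.1.union h'.1).subset ?_
    rintro x ⟨h1, h2⟩
    by_cases hx : x ∈ B
    · exact Or.inr ⟨hx, h2⟩
    · exact Or.inl ⟨h1, hx⟩
  · refine (h.2.union h'.2).subset ?_
    rintro x ⟨h1, h2⟩
    by_cases hx : x ∈ B
    · exact Or.inl ⟨hx, h2⟩
    · exact Or.inr ⟨h1, hx⟩

lemma AlmostEq.inf {A B T : Set ℤ} (h : AlmostEq A B) (hB : (B ∩ T).Infinite) :
    (A ∩ T).Infinite := by
  intro hA
  refine hB ((hA.union h.2).subset ?_)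
  rintro x ⟨h1, h2⟩
  by_cases hx : x ∈ A
  · exact Or.inl ⟨hx, h2⟩
  · exact Or.inr ⟨h1, hx⟩

lemma almostEq_all {D : Set ℤ} (hD : GoodIdx D) {S : Set ↥dendroidX} (hS : ∃ q, IsNCS S q)
    {c c' : ℝ} (hc : c ∈ Ioo (0 : ℝ) 1) (hc' : c' ∈ Ioo (0 : ℝ) 1)
    (h : AlmostEq (legIdx c S) D) : AlmostEq (legIdx c' S) D := by
  obtain ⟨q, hq⟩ := hS
  have h0 := limit_height hq hc.2 (h.inf hD.1) (h.inf hD.2)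
  exact AlmostEq.trans ⟨legIdx_diff hq h0 hc.1 hc'.2, legIdx_diff hq h0 hc'.1 hc.2⟩ h

lemma isOpen_Sc_subset {X : Type*} [TopologicalSpace X] {U : Set X} (hU : IsOpen U) :
    IsOpen {F : Sc X | F.1 ⊆ U} :=
  ⟨{F | F ⊆ U}, TopologicalSpace.isOpen_generateFrom_of_mem (Or.inl ⟨U, hU, rfl⟩), rfl⟩

lemma isOpen_Sc_hit {X : Type*} [TopologicalSpace X] {U : Set X} (hU : IsOpen U) :
    IsOpen {F : Sc X | (F.1 ∩ U).Nonempty} :=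
  ⟨{F | (F ∩ U).Nonempty},
    TopologicalSpace.isOpen_generateFrom_of_mem (Or.inr ⟨U, hU, rfl⟩), rfl⟩

lemma legIdx_const {c : ℝ} (hc : c < 1) {K : Set (Sc ↥dendroidX)} (hK : IsPreconnected K)
    (hKc : ∀ F ∈ K, F.1 ⊆ {p : ↥dendroidX | |p.1.2| ≠ c}) {F G : Sc ↥dendroidX}
    (hF : F ∈ K) (hG : G ∈ K) : legIdx c F.1 ⊆ legIdx c G.1 := by
  rintro n ⟨hn, hnF⟩
  refine ⟨hn, ?_⟩
  have := hK.subset_or_subset (isOpen_Sc_hit (isOpen_legPart hc hn))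
    (isOpen_Sc_subset (isOpen_compl_legPart c n)) ?_ ?_
  · rcases this with h | h
    · exact h hG
    · obtain ⟨p, h1, h2⟩ := hnF
      exact absurd h2 (h hF h1).2
  · rw [Set.disjoint_left]
    rintro H ⟨p, h1, h2⟩ h
    exact (h h1).2 h2
  · intro H hH
    by_cases h : (H.1 ∩ legPart c n).Nonempty
    · exact Or.inl h
    · exact Or.inr fun p hp => ⟨hKc H hH hp, fun h' => h ⟨p, hp, h'⟩⟩

lemma exists_height {S : Set ↥dendroidX} (hS : S.Countable) :
    ∃ c ∈ Ioo (0 : ℝ) 1, S ⊆ {p : ↥dendroidX | |p.1.2| ≠ c} := by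
  have h1 : ((fun p : ↥dendroidX => |p.1.2|) '' S).Countable := hS.image _
  have h2 : ¬ (Ioo (0 : ℝ) 1).Countable := by
    intro h
    have := Cardinal.le_aleph0_iff_set_countable.2 h
    rw [Cardinal.mk_Ioo_real zero_lt_one] at this
    exact absurd this (not_le.2 Cardinal.aleph0_lt_continuum)
  have : ¬ Ioo (0 : ℝ) 1 ⊆ (fun p : ↥dendroidX => |p.1.2|) '' S := fun h => h2 (h1.mono h)
  obtain ⟨c, hc, hcS⟩ := Set.not_subset.1 this
  exact ⟨c, hc, fun p hp h => hcS ⟨p, hp, h⟩⟩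

lemma joined_almostEq {D : Set ℤ} (hD : GoodIdx D) {F G : Sc ↥dendroidX} (h : Joined F G)
    (hF : ∃ c ∈ Ioo (0 : ℝ) 1, AlmostEq (legIdx c F.1) D) :
    ∃ c ∈ Ioo (0 : ℝ) 1, AlmostEq (legIdx c G.1) D := by
  obtain ⟨γ⟩ := h
  have hcont : Continuous γ.extend := γ.continuous_extend
  have hloc : IsLocallyConstant
      (fun t : ℝ => ∃ c ∈ Ioo (0 : ℝ) 1, AlmostEq (legIdx c (γ.extend t).1) D) := by
    rw [IsLocallyConstant.iff_eventually_eq]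
    intro t
    obtain ⟨q, hq⟩ := (γ.extend t).2
    obtain ⟨c, hc, hcS⟩ := exists_height hq.2.1
    have hO : IsOpen {p : ↥dendroidX | |p.1.2| ≠ c} :=
      isOpen_ne_fun (by fun_prop) (by fun_prop)
    have hO' := (isOpen_Sc_subset hO).preimage hcont
    obtain ⟨ε, hε, hball⟩ := Metric.isOpen_iff.1 hO' t hcS
    have hK : IsPreconnected (γ.extend '' Metric.ball t ε) :=
      (convex_ball t ε).isPreconnected.image _ hcont.continuousOn
    have hKc : ∀ H ∈ γ.extend '' Metric.ball t ε, H.1 ⊆ {p : ↥dendroidX | |p.1.2| ≠ c} := by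
      rintro _ ⟨s, hs, rfl⟩
      exact hball hs
    filter_upwards [Metric.ball_mem_nhds t hε] with s hs
    have ht : t ∈ Metric.ball t ε := Metric.mem_ball_self hε
    have e : legIdx c (γ.extend s).1 = legIdx c (γ.extend t).1 :=
      Set.Subset.antisymm
        (legIdx_const hc.2 hK hKc (Set.mem_image_of_mem _ hs) (Set.mem_image_of_mem _ ht))
        (legIdx_const hc.2 hK hKc (Set.mem_image_of_mem _ ht) (Set.mem_image_of_mem _ hs))
    apply propext
    constructor
    · rintro ⟨d, hd, h⟩
      exact ⟨c, hc, e ▸ almostEq_all hD (γ.extend s).2 hd hc h⟩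
    · rintro ⟨d, hd, h⟩
      exact ⟨c, hc, e ▸ almostEq_all hD (γ.extend t).2 hd hc h⟩
  have := hloc.apply_eq_of_preconnectedSpace 0 1
  simp only [Path.extend_zero, Path.extend_one] at this
  rw [← this]; exact hF

/-- The sequence of tips with index in `D`. -/
noncomputable def tipSeq (D : Set ℤ) (h0 : ∀ n ∈ D, n ≠ 0) : D → ↥dendroidX :=
  fun n => ⟨xPt n.1, xPt_mem (h0 n.1 n.2)⟩

lemma tip_isNCS (D : Set ℤ) (h0 : ∀ n ∈ D, n ≠ 0) (hD : D.Infinite) :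
    IsNCS (insert ⟨vPt, vPt_mem⟩ (range (tipSeq D h0))) ⟨vPt, vPt_mem⟩ := by
  haveI : Infinite D := hD.to_subtype
  refine isNCS_of_tendsto _ _ ?_ ?_
  · intro a b h
    have h1 := congrArg (fun p : ↥dendroidX => p.1.1) h
    simp only [tipSeq, xPt, one_div, inv_inj, Int.cast_inj] at h1
    exact Subtype.ext h1
  · rw [tendsto_subtype_rng]
    have h1 : Tendsto (fun n : ℤ => ((n : ℝ))⁻¹) cofinite (𝓝 0) :=
      tendsto_inv₀_cobounded.comp (by
        have := Int.tendsto_coe_cofinite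
        rwa [← Metric.cobounded_eq_cocompact] at this)
    have h2 : Tendsto (fun n : D => (((n.1 : ℤ) : ℝ))⁻¹) cofinite (𝓝 0) :=
      h1.comp Subtype.val_injective.tendsto_cofinite
    have h3 : Tendsto (fun n : D => ((((n.1 : ℤ) : ℝ))⁻¹, (0 : ℝ))) cofinite (𝓝 ((0 : ℝ), (0 : ℝ))) :=
      h2.prodMk_nhds tendsto_const_nhds
    simpa [tipSeq, xPt, vPt] using h3

lemma legIdx_tip (D : Set ℤ) (h0 : ∀ n ∈ D, n ≠ 0) {c : ℝ} (hc : 0 < c) :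
    legIdx c (insert ⟨vPt, vPt_mem⟩ (range (tipSeq D h0))) = D := by
  ext n
  constructor
  · rintro ⟨hn, p, hp, hp1, hp2⟩
    rcases hp with rfl | ⟨m, rfl⟩
    · simp [vPt] at hp2
    · have hm : ((m.1 : ℤ) : ℝ) ≠ 0 := by exact_mod_cast h0 _ m.2
      simp only [tipSeq, xPt, abs_zero, sub_zero] at hp2
      field_simp at hp2
      have : n = m.1 := by exact_mod_cast hp2
      rw [this]; exact m.2
  · intro hn
    have hm : (n : ℝ) ≠ 0 := by exact_mod_cast h0 _ hn
    refine ⟨h0 _ hn, tipSeq D h0 ⟨n, hn⟩, Or.inr ⟨_, rfl⟩, ?_, ?_⟩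
    · simpa [tipSeq, xPt] using hc
    · simp [tipSeq, xPt, hm]

/-- Index set coded by `s`. -/
def codeIdx (s : Set ℕ) : Set ℤ :=
  {n | n < 0 ∨ ∃ i k : ℕ, (i = 0 ∨ ∃ j ∈ s, i = j + 1) ∧ n = (Nat.pair i k : ℤ) + 1}

lemma codeIdx_ne (s : Set ℕ) : ∀ n ∈ codeIdx s, n ≠ 0 := by
  rintro n (h | ⟨i, k, -, rfl⟩)
  · exact h.ne
  · positivity

lemma inf_pair (i : ℕ) : (range fun k : ℕ => (Nat.pair i k : ℤ) + 1).Infinite := by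
  refine Set.infinite_range_of_injective ?_
  intro a b h
  simp only [add_left_inj, Nat.cast_inj, Nat.pair_eq_pair] at h
  exact h.2

lemma codeIdx_good (s : Set ℕ) : GoodIdx (codeIdx s) := by
  constructor
  · refine (inf_pair 0).mono ?_
    rintro _ ⟨k, rfl⟩
    refine ⟨Or.inr ⟨0, k, Or.inl rfl, rfl⟩, ?_⟩
    simp only [Set.mem_setOf_eq]; positivity
  · refine (Set.Iio_infinite (0 : ℤ)).mono ?_
    intro n hn
    exact ⟨Or.inl hn, hn⟩

lemma codeIdx_sub {s t : Set ℕ} (h : (codeIdx s \ codeIdx t).Finite) : s ⊆ t := by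
  intro j hj
  by_contra hjt
  refine (inf_pair (j + 1)) (h.subset ?_)
  rintro _ ⟨k, rfl⟩
  refine ⟨Or.inr ⟨j + 1, k, Or.inr ⟨j, hj, rfl⟩, rfl⟩, ?_⟩
  rintro (h | ⟨i, l, h, e⟩)
  · have : (0 : ℤ) ≤ (Nat.pair (j + 1) k : ℤ) + 1 := by positivity
    exact absurd h this.not_gt
  · simp only [add_left_inj, Nat.cast_inj, Nat.pair_eq_pair] at e
    rcases h with rfl | ⟨j', hj', rfl⟩
    · omega
    · have : j = j' := by omega
      exact hjt (this ▸ hj')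

/-- The point of the hyperspace coded by `s`. -/
noncomputable def codeSeq (s : Set ℕ) : Sc ↥dendroidX :=
  ⟨insert ⟨vPt, vPt_mem⟩ (range (tipSeq (codeIdx s) (codeIdx_ne s))),
    ⟨vPt, vPt_mem⟩, tip_isNCS _ _ ((codeIdx_good s).1.mono Set.inter_subset_left)⟩

lemma codeSeq_inj {s t : Set ℕ} (h : Joined (codeSeq s) (codeSeq t)) : s = t := by
  have half : (1/2 : ℝ) ∈ Ioo (0 : ℝ) 1 := ⟨by norm_num, by norm_num⟩
  obtain ⟨c, hc, h1⟩ := joined_almostEq (codeIdx_good s) h ⟨1/2, half, by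
    have : legIdx (1/2) (codeSeq s).1 = codeIdx s := legIdx_tip _ _ half.1
    rw [this]; simp [AlmostEq]⟩
  have : legIdx c (codeSeq t).1 = codeIdx t := legIdx_tip _ _ hc.1
  rw [this] at h1
  exact Set.Subset.antisymm (codeIdx_sub h1.2) (codeIdx_sub h1.1)

lemma mk_Sc_le : Cardinal.mk (Sc ↥dendroidX) ≤ Cardinal.continuum := by
  have h : ∀ S : Sc ↥dendroidX, ∃ f : ℕ → ↥dendroidX, S.1 = range f := by
    rintro ⟨S, q, hq⟩
    exact hq.2.1.exists_eq_range ⟨q, hq.2.2.2.1⟩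
  choose f hf using h
  have hinj : Function.Injective (fun S n => (f S n : ℝ × ℝ)) := by
    intro S T hST
    have : f S = f T := by
      funext n
      exact Subtype.ext (congrFun hST n)
    exact Subtype.ext (by rw [hf S, hf T, this])
  refine (Cardinal.mk_le_of_injective hinj).trans ?_
  simp [Cardinal.mk_real]

/-- The hyperspace `S_c(X)` of the dendroid above has exactly `𝔠`-many path-wise
connected components. -/
theorem stmt_18 :
    Cardinal.mk
      (Set.range (fun S : Sc ↥dendroidX => pathComponent S)) =
      Cardinal.continuum := by

  refine le_antisymm (Cardinal.mk_range_le.trans mk_Sc_le) ?_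
  have hinj : Function.Injective (fun s : Set ℕ =>
      (⟨pathComponent (codeSeq s), codeSeq s, rfl⟩ :
        Set.range (fun S : Sc ↥dendroidX => pathComponent S))) := by
    intro s t h
    have h' : pathComponent (codeSeq s) = pathComponent (codeSeq t) := congrArg Subtype.val h
    have : codeSeq t ∈ pathComponent (codeSeq s) := by
      rw [h']; exact mem_pathComponent_self _
    exact codeSeq_inj this
  have := Cardinal.mk_le_of_injective hinj
  rwa [Cardinal.mk_set, Cardinal.mk_nat, Cardinal.two_power_aleph0] at this
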